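/- Every element f ∈ Λ fixed by σ (i.e. every C₃-invariant, where C₃ = ⟨σ⟩ is the cyclic subgroup of order 3 of S₃) can be written uniquely as f = u + d·v with u, v ∈ Λ^{S₃}. In other words, Λ^{C₃} = Λ^{S₃} ⊕ d·Λ^{S₃} as Λ^{S₃}-modules. -/

import Mathlib

open MvPolynomial

set_option synthInstance.maxHeartbeats 1000000
set_option maxHeartbeats 4000000

noncomputable section

/-- The ring ℤ[1/2], realized as the subring of ℚ generated by 1/2. -/
abbrev R2 : Type := Subring.closure {(2⁻¹ : ℚ)}

/-- Λ = ℤ[1/2][λ₁, λ₂], with λ₁ = X 0 and λ₂ = X 1. -/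
abbrev Lam : Type := MvPolynomial (Fin 2) R2

/-- A chosen 3-cycle σ₀ in S₃ = Perm (Fin 3). -/
def sig0 : Equiv.Perm (Fin 3) := finRotate 3

/-- A chosen transposition τ₀ in S₃ = Perm (Fin 3); note `tau0 * sig0 * tau0 = sig0 ^ 2`. -/
def tau0 : Equiv.Perm (Fin 3) := Equiv.swap 1 2

/-- c₄ = 16(λ₁² − λ₁λ₂ + λ₂²). -/
def cFour : Lam := 16 * (X 0 ^ 2 - X 0 * X 1 + X 1 ^ 2)

/-- c₆ = 32(λ₁ + λ₂)(2λ₁² − 5λ₁λ₂ + 2λ₂²). -/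
def cSix : Lam := 32 * (X 0 + X 1) * (2 * X 0 ^ 2 - 5 * X 0 * X 1 + 2 * X 1 ^ 2)

/-- Δ = 16λ₁²λ₂²(λ₁ − λ₂)². -/
def Del : Lam := 16 * X 0 ^ 2 * X 1 ^ 2 * (X 0 - X 1) ^ 2

/-- d = λ₁λ₂(λ₁ − λ₂). -/
def dE : Lam := X 0 * X 1 * (X 0 - X 1)

/-- The subalgebra Λ^{S₃} of invariants for an action ρ of S₃ on Λ by
ℤ[1/2]-algebra automorphisms. -/
def invS (ρ : Equiv.Perm (Fin 3) →* (Lam ≃ₐ[R2] Lam)) : Subalgebra R2 Lam where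
  carrier := {f | ∀ g, ρ g f = f}
  mul_mem' := fun hf hg g => by rw [map_mul, hf g, hg g]
  add_mem' := fun hf hg g => by rw [map_add, hf g, hg g]
  algebraMap_mem' := fun r g => by rw [AlgEquiv.commutes]

end

theorem sub_swap_dvd_sub_apply (φ : Lam ≃ₐ[R2] Lam) (h₁ : φ (X 0) = X 1) (h₂ : φ (X 1) = X 0)
    (f : Lam) : (X 0 - X 1 : Lam) ∣ f - φ f := by
  rw [← Ideal.mem_span_singleton, ← Ideal.Quotient.eq]
  have h01 : Ideal.Quotient.mk (Ideal.span {(X 0 - X 1 : Lam)}) (X 0) =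
      Ideal.Quotient.mk (Ideal.span {(X 0 - X 1 : Lam)}) (X 1) :=
    Ideal.Quotient.eq.2 (Ideal.mem_span_singleton_self _)
  have key : Ideal.Quotient.mkₐ R2 (Ideal.span {(X 0 - X 1 : Lam)}) =
      (Ideal.Quotient.mkₐ R2 (Ideal.span {(X 0 - X 1 : Lam)})).comp φ.toAlgHom := by
    apply MvPolynomial.algHom_ext
    intro i
    fin_cases i
    · simpa [h₁] using h01
    · simpa [h₂] using h01.symm
  exact DFunLike.congr_fun key f

theorem dE_dvd {g : Lam} (h₀ : X 0 ∣ g) (h₁ : X 1 ∣ g) (h₂ : X 0 - X 1 ∣ g) : dE ∣ g := by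
  have eval_ne (a b : R2) (p q : Lam) (h : eval ![a, b] p = 0) (h' : eval ![a, b] q ≠ 0) :
      ¬ p ∣ q := by
    rintro ⟨r, rfl⟩
    exact h' (by rw [map_mul, h, zero_mul])
  obtain ⟨k, rfl⟩ := h₂
  have hk : X 1 ∣ k := ((X_prime (i := 1)).dvd_or_dvd h₁).resolve_left
    (eval_ne 1 0 _ _ (by simp) (by simp))
  obtain ⟨l, rfl⟩ := hk
  have hl : X 0 ∣ X 1 * l := ((X_prime (i := 0)).dvd_or_dvd h₀).resolve_left
    (eval_ne 0 1 _ _ (by simp) (by simp))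
  have hm : X 0 ∣ l := ((X_prime (i := 0)).dvd_or_dvd hl).resolve_left
    (eval_ne 0 1 _ _ (by simp) (by simp))
  obtain ⟨m, rfl⟩ := hm
  exact ⟨m, by unfold dE; ring⟩

theorem dE_ne_zero : dE ≠ 0 := by
  intro h
  have := congrArg (eval ![(2 : R2), 1]) h
  norm_num [dE] at this

theorem perm_eq_sig0_pow_mul_tau0_pow (g : Equiv.Perm (Fin 3)) :
    ∃ i j : Fin 3, g = sig0 ^ (i : ℕ) * tau0 ^ (j : ℕ) := by
  revert g
  unfold sig0 tau0
  decide

theorem mem_invS_of_generators {ρ : Equiv.Perm (Fin 3) →* (Lam ≃ₐ[R2] Lam)} {f : Lam}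
    (hσ : ρ sig0 f = f) (hτ : ρ tau0 f = f) : f ∈ invS ρ := by
  have pow_fixed (φ : Lam ≃ₐ[R2] Lam) (h : φ f = f) (n : ℕ) : (φ ^ n) f = f := by
    induction n with
    | zero => rfl
    | succ n ih => rw [pow_succ, AlgEquiv.mul_apply, h, ih]
  intro g
  obtain ⟨i, j, rfl⟩ := perm_eq_sig0_pow_mul_tau0_pow g
  rw [map_mul, map_pow, map_pow, AlgEquiv.mul_apply, pow_fixed _ hτ, pow_fixed _ hσ]

theorem exists_two_mul_C_eq_one : ∃ c : R2, (2 : Lam) * C c = 1 := by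
  refine ⟨⟨2⁻¹, Subring.subset_closure rfl⟩, ?_⟩
  rw [← map_ofNat C 2, ← C_mul, ← C_1]
  congr 1
  apply Subtype.ext
  exact mul_inv_cancel₀ (two_ne_zero (α := ℚ))

/-!
STATEMENT 5: Every f ∈ Λ fixed by σ (i.e. every C₃-invariant, C₃ = ⟨σ⟩ ≤ S₃) can be
written uniquely as f = u + d·v with u, v ∈ Λ^{S₃}; that is,
Λ^{C₃} = Λ^{S₃} ⊕ d·Λ^{S₃} as Λ^{S₃}-modules.
-/

theorem statement5 (ρ : Equiv.Perm (Fin 3) →* (Lam ≃ₐ[R2] Lam))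
    (hσ₁ : ρ sig0 (X 0) = X 1 - X 0) (hσ₂ : ρ sig0 (X 1) = - X 0)
    (hτ₁ : ρ tau0 (X 0) = X 1) (hτ₂ : ρ tau0 (X 1) = X 0) :
    ∀ f : Lam, ρ sig0 f = f →
      ∃! uv : Lam × Lam, uv.1 ∈ invS ρ ∧ uv.2 ∈ invS ρ ∧ f = uv.1 + dE * uv.2 := by
  intro f hf
  have hdσ : ρ sig0 dE = dE := by
    simp only [dE, map_mul, map_sub, hσ₁, hσ₂]; ring
  have hdτ : ρ tau0 dE = -dE := by
    simp only [dE, map_mul, map_sub, hτ₁, hτ₂]; ring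
  have hττ (p : Lam) : ρ tau0 (ρ tau0 p) = p := by
    rw [← AlgEquiv.mul_apply, ← map_mul, show tau0 * tau0 = 1 by unfold tau0; decide, map_one]
    rfl
  have hστ : ρ sig0 (ρ tau0 f) = ρ tau0 f := by
    rw [← AlgEquiv.mul_apply, ← map_mul,
      show sig0 * tau0 = tau0 * sig0 * sig0 by unfold sig0 tau0; decide,
      map_mul, map_mul, AlgEquiv.mul_apply, AlgEquiv.mul_apply, hf, hf]
  obtain ⟨c, hc⟩ := exists_two_mul_C_eq_one
  have hC (g : Equiv.Perm (Fin 3)) : ρ g (C c) = C c := (ρ g).commutes c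
  have hσg : ρ sig0 (f - ρ tau0 f) = f - ρ tau0 f := by rw [map_sub, hf, hστ]
  have hd₂ := sub_swap_dvd_sub_apply (ρ tau0) hτ₁ hτ₂ f
  have hd₁ : X 1 ∣ f - ρ tau0 f := by
    have := map_dvd (ρ sig0) hd₂
    rw [hσg, map_sub, hσ₁, hσ₂] at this
    simpa using this
  have hd₀ : X 0 ∣ f - ρ tau0 f := by
    have := map_dvd (ρ sig0) hd₁
    rw [hσg, hσ₂] at this
    exact (neg_dvd (α := Lam)).1 this
  obtain ⟨w, hw⟩ := dE_dvd hd₀ hd₁ hd₂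
  have hwσ : ρ sig0 w = w := by
    apply mul_left_cancel₀ dE_ne_zero
    rw [← hw, ← hσg, hw, map_mul, hdσ]
  have hwτ : ρ tau0 w = w := by
    apply mul_left_cancel₀ dE_ne_zero
    have h := congrArg (ρ tau0) hw
    rw [map_sub, hττ, map_mul, hdτ] at h
    linear_combination h + hw
  refine ⟨(C c * (f + ρ tau0 f), C c * w), ⟨?_, ?_, ?_⟩, ?_⟩
  · apply mem_invS_of_generators
    · rw [map_mul, map_add, hC, hf, hστ]
    · rw [map_mul, map_add, hC, hττ, add_comm]
  · apply mem_invS_of_generators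
    · rw [map_mul, hC, hwσ]
    · rw [map_mul, hC, hwτ]
  · linear_combination C c * hw - f * hc
  · rintro ⟨u, v⟩ ⟨hu, hv, h⟩
    have h' : ρ tau0 f = u - dE * v := by
      rw [h, map_add, map_mul, hdτ, hu, hv]; ring
    have hv' : w = 2 * v := by
      apply mul_left_cancel₀ dE_ne_zero
      linear_combination h - h' - hw
    ext1
    · linear_combination -u * hc - C c * (h + h')
    · linear_combination -v * hc - C c * hv'
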